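/- Let Q and Q' be full unions of conjunctive queries with negation and inequalities (full UCQ¬,≠), where Q has disjuncts Q₁,…,Qₙ and Q' has m disjuncts. If there are an instance I and a fact f with f ∈ Q(I) and f ∉ Q'(I), then there are an instance J ⊆ I with |J| ≤ max_{i∈{1,…,n}} |pos(Qᵢ)| + m and f ∈ Q(J) and f ∉ Q'(J). -/

import Mathlib

/-- An atom `R(x₁,…,x_k)`: a relation name together with a tuple of variables. -/
structure Atom (R V : Type) where
  rel : R
  args : List V
deriving DecidableEq

/-- A fact `R(t)`: a relation name together with a tuple of data values. -/
structure DBFact (R D : Type) where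
  rel : R
  args : List D
deriving DecidableEq

/-- Applying a valuation to an atom yields a fact. -/
def Atom.app {R V D : Type} (f : V → D) (a : Atom R V) : DBFact R D :=
  ⟨a.rel, a.args.map f⟩

/-- The variables occurring in an atom. -/
def Atom.vars {R V : Type} (a : Atom R V) : Set V := {v | v ∈ a.args}

/-- A conjunctive query with negation and inequalities (CQ¬,≠): a head atom,
finite sets of positive and negated body atoms, and a finite set of
inequalities between variables. -/
structure CQ (R V : Type) where
  head : Atom R V
  pos : Finset (Atom R V)
  neg : Finset (Atom R V)
  ineq : Finset (V × V)

namespace CQ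

variable {R V D : Type}

/-- The variables occurring in a query. -/
def vars (Q : CQ R V) : Set V :=
  Q.head.vars ∪ (⋃ a ∈ (↑Q.pos : Set (Atom R V)), a.vars) ∪
    (⋃ a ∈ (↑Q.neg : Set (Atom R V)), a.vars) ∪
    (⋃ p ∈ (↑Q.ineq : Set (V × V)), {p.1, p.2})

/-- Safety: every head variable and every variable of a negated atom occurs in
some positive atom. -/
def safe (Q : CQ R V) : Prop :=
  (∀ v ∈ Q.head.vars, ∃ a ∈ Q.pos, v ∈ a.args) ∧
  (∀ a ∈ Q.neg, ∀ v ∈ a.args, ∃ b ∈ Q.pos, v ∈ b.args)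

/-- A query is full if every one of its variables occurs in its head atom. -/
def isFull (Q : CQ R V) : Prop := ∀ v ∈ Q.vars, v ∈ Q.head.args

/-- The facts required by a valuation `f`: `f(pos(Q))`. -/
def posFacts (Q : CQ R V) (f : V → D) : Set (DBFact R D) :=
  Atom.app f '' (↑Q.pos : Set (Atom R V))

/-- The facts prohibited by a valuation `f`: `f(neg(Q))`. -/
def negFacts (Q : CQ R V) (f : V → D) : Set (DBFact R D) :=
  Atom.app f '' (↑Q.neg : Set (Atom R V))

/-- `f` is a valuation for `Q`: required and prohibited facts are disjoint and
all inequalities are respected. -/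
def isVal (Q : CQ R V) (f : V → D) : Prop :=
  Q.posFacts f ∩ Q.negFacts f = ∅ ∧
  ∀ p ∈ Q.ineq, f p.1 ≠ f p.2

/-- `f` satisfies `Q` on `I`: all required facts are in `I` and no prohibited
fact is in `I`. -/
def sat (Q : CQ R V) (f : V → D) (I : Set (DBFact R D)) : Prop :=
  Q.posFacts f ⊆ I ∧ Q.negFacts f ∩ I = ∅

/-- `Q(I)`: the set of facts derived on `I` by valuations satisfying `Q`. -/
def eval (Q : CQ R V) (I : Set (DBFact R D)) : Set (DBFact R D) :=
  {fc | ∃ f : V → D, Q.isVal f ∧ Q.sat f I ∧ Atom.app f Q.head = fc}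

end CQ

/-- A union of conjunctive queries (with negation and inequalities): a finite,
nonempty family of CQ¬,≠s. -/
structure UCQ (R V : Type) where
  n : ℕ
  npos : 0 < n
  disj : Fin n → CQ R V

namespace UCQ

variable {R V D : Type}

/-- Well-formedness of a UCQ: every disjunct is safe, all disjuncts have the
same head relation, and distinct disjuncts have disjoint variable sets. -/
def wf (Q : UCQ R V) : Prop :=
  (∀ i, (Q.disj i).safe) ∧
  (∀ i j, (Q.disj i).head.rel = (Q.disj j).head.rel) ∧
  (∀ i j, i ≠ j → Disjoint (Q.disj i).vars (Q.disj j).vars)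

/-- `Q(I) = ⋃ᵢ Qᵢ(I)`. -/
def eval (Q : UCQ R V) (I : Set (DBFact R D)) : Set (DBFact R D) :=
  ⋃ i, (Q.disj i).eval I

/-- The maximum number of variables of any disjunct. -/
noncomputable def varmax (Q : UCQ R V) : ℕ :=
  Finset.univ.sup fun i => ((Q.disj i).vars).ncard

end UCQ

/-- The values of the fact all belong to `U`. -/
def DBFact.valsIn {R D : Type} (fc : DBFact R D) (U : Set D) : Prop :=
  ∀ d ∈ fc.args, d ∈ U

/-- The active domain of an instance: all data values occurring in it. -/
def adom {R D : Type} (I : Set (DBFact R D)) : Set D :=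
  {d | ∃ fc ∈ I, d ∈ fc.args}

namespace CQ

variable {R V D : Type}

/-- Two valuations of a full query that derive the same fact prohibit the same facts. -/
lemma isFull.negFacts_eq {Q : CQ R V} (hQ : Q.isFull) {g g' : V → D}
    (h : Atom.app g Q.head = Atom.app g' Q.head) : Q.negFacts g = Q.negFacts g' := by
  have hhead : ∀ v ∈ Q.head.args, g v = g' v :=
    List.map_inj_left.mp (congrArg DBFact.args h)
  refine Set.image_congr fun a ha => ?_
  refine congrArg (DBFact.mk a.rel) (List.map_inj_left.mpr fun v hv => hhead v (hQ v ?_))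
  exact Or.inl (Or.inr (Set.mem_biUnion ha hv))

/-- If a full query does not derive `f` on `I`, then some set of at most one fact of `I`
prevents it from deriving `f` on every instance between that set and `I`. -/
lemma isFull.exists_blocking {Q : CQ R V} (hQ : Q.isFull) {I : Set (DBFact R D)}
    {f : DBFact R D} (hf : f ∉ Q.eval I) :
    ∃ S : Finset (DBFact R D), ↑S ⊆ I ∧ S.card ≤ 1 ∧
      ∀ K : Set (DBFact R D), ↑S ⊆ K → K ⊆ I → f ∉ Q.eval K := by
  by_cases h : ∃ g : V → D, Q.isVal g ∧ Q.posFacts g ⊆ I ∧ Atom.app g Q.head = f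
  · obtain ⟨g, hval, hpos, hhead⟩ := h
    have hne : (Q.negFacts g ∩ I).Nonempty := by
      rw [Set.nonempty_iff_ne_empty]
      exact fun hneg => hf ⟨g, hval, ⟨hpos, hneg⟩, hhead⟩
    obtain ⟨b, hbneg, hbI⟩ := hne
    refine ⟨{b}, by simpa using hbI, by simp, ?_⟩
    rintro K hSK - ⟨g', -, ⟨-, hneg⟩, hhead'⟩
    have hbK : b ∈ K := hSK (by simp)
    rw [hQ.negFacts_eq (hhead'.trans hhead.symm)] at hneg
    exact Set.notMem_empty b (hneg ▸ ⟨hbneg, hbK⟩)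
  · refine ⟨∅, by simp, by simp, ?_⟩
    rintro K - hKI ⟨g, hval, ⟨hpos, -⟩, hhead⟩
    exact h ⟨g, hval, hpos.trans hKI, hhead⟩

end CQ

/-- For full UCQ¬,≠s `Q` (with `n` disjuncts) and `Q'` (with
`m` disjuncts), any counterexample `I` to containment with witnessing fact `f`
can be shrunk to `J ⊆ I` of size at most `maxᵢ |pos(Qᵢ)| + m`. -/
theorem full_ucq_containment_small_counterexample {R V D : Type} [Infinite D]
    (Q Q' : UCQ R V) (hQ : Q.wf) (hQ' : Q'.wf)
    (hfull : ∀ i, (Q.disj i).isFull) (hfull' : ∀ i, (Q'.disj i).isFull)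
    (I : Set (DBFact R D)) (hI : I.Finite) (f : DBFact R D)
    (hin : f ∈ Q.eval I) (hout : f ∉ Q'.eval I) :
    ∃ J ⊆ I,
      J.ncard ≤ (Finset.univ.sup fun i => (Q.disj i).pos.card) + Q'.n ∧
      f ∈ Q.eval J ∧ f ∉ Q'.eval J := by
  classical
  obtain ⟨i, g, hval, ⟨hpos, hneg⟩, hhead⟩ := Set.mem_iUnion.mp hin
  have hout' : ∀ j, f ∉ (Q'.disj j).eval I := fun j hj => hout (Set.mem_iUnion.mpr ⟨j, hj⟩)
  choose S hSI hScard hS using fun j => (hfull' j).exists_blocking (hout' j)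
  let P : Finset (DBFact R D) := (Q.disj i).pos.image (Atom.app g)
  have hP : (P : Set (DBFact R D)) = (Q.disj i).posFacts g := Finset.coe_image
  let J : Finset (DBFact R D) := P ∪ Finset.univ.biUnion S
  have hJ : (J : Set (DBFact R D)) = (Q.disj i).posFacts g ∪ ⋃ j, ↑(S j) := by
    simp [J, hP]
  have hJI : (J : Set (DBFact R D)) ⊆ I := hJ ▸ Set.union_subset hpos (Set.iUnion_subset hSI)
  refine ⟨J, hJI, ?_, ?_, ?_⟩
  · rw [Set.ncard_coe_finset]
    refine (Finset.card_union_le _ _).trans (Nat.add_le_add ?_ ?_)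
    · exact Finset.card_image_le.trans
        (Finset.le_sup (f := fun i => (Q.disj i).pos.card) (Finset.mem_univ i))
    · simpa using Finset.card_biUnion_le_card_mul Finset.univ S 1 fun j _ => hScard j
  · refine Set.mem_iUnion.mpr ⟨i, g, hval, ⟨hJ ▸ Set.subset_union_left, ?_⟩, hhead⟩
    exact Set.subset_empty_iff.mp (hneg ▸ Set.inter_subset_inter_right _ hJI)
  · rw [UCQ.eval, Set.mem_iUnion, not_exists]
    refine fun j => hS j J ?_ hJI
    exact hJ ▸ (Set.subset_iUnion (fun j => (S j : Set (DBFact R D))) j).trans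
      Set.subset_union_right
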